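/- Let (H, μ, Δ, α_H, σ) be a coquasitriangular Hom-bialgebra with α_H bijective and σ = σ∘(α_H⊗α_H), and let (M, α_M), (N, α_N), (P, α_P) be left H-comodules with bijective structure maps. Define c_{X,Y}: X⊗Y → Y⊗X by c_{X,Y}(x⊗y) = σ(y_{(-1)}⊗x_{(-1)}) α_Y^{-1}(y_{(0)})⊗α_X^{-1}(x_{(0)}) and associators 𝔞_{X,Y,Z}((x⊗y)⊗z) = α_X(x)⊗(y⊗α_Z^{-1}(z)), where tensor products of comodules carry the coaction x⊗y ↦ x_{(-1)}y_{(-1)}⊗(x_{(0)}⊗y_{(0)}). Then (α_N⊗α_M)∘c_{M,N} = c_{M,N}∘(α_M⊗α_N), c_{M,N} is a morphism of left H-comodules, the braid relation (id_P⊗c_{M,N})∘(c_{M,P}⊗id_N)∘(id_M⊗c_{N,P}) = (c_{N,P}⊗id_M)∘(id_N⊗c_{M,P})∘(c_{M,N}⊗id_P) holds, and the two hexagon relations hold: 𝔞_{N,P,M}∘c_{M,N⊗P}∘𝔞_{M,N,P} = (id_N⊗c_{M,P})∘𝔞_{N,M,P}∘(c_{M,N}⊗id_P) and 𝔞_{P,M,N}^{-1}∘c_{M⊗N,P}∘𝔞_{M,N,P}^{-1}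 = (c_{M,P}⊗id_N)∘𝔞_{M,P,N}^{-1}∘(id_M⊗c_{N,P}). -/

import Mathlib

open TensorProduct

noncomputable section

namespace HomYD

variable (k : Type*) [Field k]
variable {H M N : Type*}
variable [AddCommGroup H] [Module k H]
variable [AddCommGroup M] [Module k M]
variable [AddCommGroup N] [Module k N]

/-- Rearrangement `(a ⊗ b) ⊗ c ↦ (a ⊗ c) ⊗ b`. -/
def rearr (A B C : Type*) [AddCommGroup A] [Module k A] [AddCommGroup B] [Module k B]
    [AddCommGroup C] [Module k C] :
    (A ⊗[k] B) ⊗[k] C →ₗ[k] (A ⊗[k] C) ⊗[k] B :=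
  (TensorProduct.assoc k A C B).symm.toLinearMap ∘ₗ
    (TensorProduct.map LinearMap.id (TensorProduct.comm k B C).toLinearMap) ∘ₗ
      (TensorProduct.assoc k A B C).toLinearMap

/-- Middle-four exchange `(a ⊗ b) ⊗ (c ⊗ d) ↦ (a ⊗ c) ⊗ (b ⊗ d)`. -/
def ttc (A B C D : Type*) [AddCommGroup A] [Module k A] [AddCommGroup B] [Module k B]
    [AddCommGroup C] [Module k C] [AddCommGroup D] [Module k D] :
    (A ⊗[k] B) ⊗[k] (C ⊗[k] D) →ₗ[k] (A ⊗[k] C) ⊗[k] (B ⊗[k] D) :=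
  (TensorProduct.tensorTensorTensorComm k A B C D).toLinearMap

/-- Hom-bialgebra (no unit/counit): multiplicativity of `α`, Hom-associativity,
comultiplicativity of `α`, Hom-coassociativity, and `Δ` multiplicative. -/
structure IsHomBialgebra (μ : H ⊗[k] H →ₗ[k] H) (Δ : H →ₗ[k] H ⊗[k] H)
    (α : H →ₗ[k] H) : Prop where
  mul_mult : ∀ a b : H, α (μ (a ⊗ₜ[k] b)) = μ (α a ⊗ₜ[k] α b)
  hom_assoc : ∀ a b c : H, μ (α a ⊗ₜ[k] μ (b ⊗ₜ[k] c)) = μ (μ (a ⊗ₜ[k] b) ⊗ₜ[k] α c)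
  comul_compat : TensorProduct.map α α ∘ₗ Δ = Δ ∘ₗ α
  hom_coassoc : (TensorProduct.assoc k H H H).toLinearMap ∘ₗ TensorProduct.map Δ α ∘ₗ Δ
      = TensorProduct.map α Δ ∘ₗ Δ
  comul_mul : Δ ∘ₗ μ
      = TensorProduct.map μ μ ∘ₗ ttc k H H H H ∘ₗ TensorProduct.map Δ Δ

/-- Left module over a Hom-(bi)algebra. -/
structure IsHomModule (μ : H ⊗[k] H →ₗ[k] H) (α : H →ₗ[k] H)
    (ρ : H ⊗[k] M →ₗ[k] M) (αM : M →ₗ[k] M) : Prop where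
  str_compat : ∀ (h : H) (m : M), αM (ρ (h ⊗ₜ[k] m)) = ρ (α h ⊗ₜ[k] αM m)
  hom_smul : ∀ (h h' : H) (m : M),
      ρ (α h ⊗ₜ[k] ρ (h' ⊗ₜ[k] m)) = ρ (μ (h ⊗ₜ[k] h') ⊗ₜ[k] αM m)

/-- Left comodule over a Hom-(bi)algebra. -/
structure IsHomComodule (Δ : H →ₗ[k] H ⊗[k] H) (α : H →ₗ[k] H)
    (lM : M →ₗ[k] H ⊗[k] M) (αM : M →ₗ[k] M) : Prop where
  str_compat : TensorProduct.map α αM ∘ₗ lM = lM ∘ₗ αM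
  hom_coact : TensorProduct.map Δ αM ∘ₗ lM
      = (TensorProduct.assoc k H H M).symm.toLinearMap ∘ₗ TensorProduct.map α lM ∘ₗ lM

/-- `h ⊗ m ↦ (h₁·m)₍₋₁₎ β(h₂) ⊗ (h₁·m)₍₀₎`. -/
def ydL (μ : H ⊗[k] H →ₗ[k] H) (Δ : H →ₗ[k] H ⊗[k] H) (β : H →ₗ[k] H)
    (ρ : H ⊗[k] M →ₗ[k] M) (lM : M →ₗ[k] H ⊗[k] M) : H ⊗[k] M →ₗ[k] H ⊗[k] M :=
  TensorProduct.map μ LinearMap.id ∘ₗ rearr k H M H ∘ₗ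
    TensorProduct.map (lM ∘ₗ ρ) β ∘ₗ rearr k H H M ∘ₗ
      TensorProduct.map Δ LinearMap.id

/-- `h ⊗ m ↦ β(h₁) γ(m₍₋₁₎) ⊗ γ(h₂)·m₍₀₎`. -/
def ydR (μ : H ⊗[k] H →ₗ[k] H) (Δ : H →ₗ[k] H ⊗[k] H) (β γ : H →ₗ[k] H)
    (ρ : H ⊗[k] M →ₗ[k] M) (lM : M →ₗ[k] H ⊗[k] M) : H ⊗[k] M →ₗ[k] H ⊗[k] M :=
  TensorProduct.map (μ ∘ₗ TensorProduct.map β γ) (ρ ∘ₗ TensorProduct.map γ LinearMap.id) ∘ₗ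
    ttc k H H H M ∘ₗ TensorProduct.map Δ lM

/-- Yetter-Drinfeld module over a Hom-bialgebra: Hom-module, Hom-comodule and the
compatibility `(h₁·m)₍₋₁₎ α²(h₂) ⊗ (h₁·m)₍₀₎ = α²(h₁) α(m₍₋₁₎) ⊗ α(h₂)·m₍₀₎`. -/
def IsYetterDrinfeld (μ : H ⊗[k] H →ₗ[k] H) (Δ : H →ₗ[k] H ⊗[k] H) (α : H →ₗ[k] H)
    (ρ : H ⊗[k] M →ₗ[k] M) (lM : M →ₗ[k] H ⊗[k] M) (αM : M →ₗ[k] M) : Prop :=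
  IsHomModule k μ α ρ αM ∧ IsHomComodule k Δ α lM αM ∧
    ydL k μ Δ (α ∘ₗ α) ρ lM = ydR k μ Δ (α ∘ₗ α) α ρ lM

/-- `m ⊗ n ↦ αHinv(m₍₋₁₎)·n ⊗ m₍₀₎`. -/
def Bmap (αHinv : H →ₗ[k] H) (lM : M →ₗ[k] H ⊗[k] M) (ρN : H ⊗[k] N →ₗ[k] N) :
    M ⊗[k] N →ₗ[k] N ⊗[k] M :=
  TensorProduct.map (ρN ∘ₗ TensorProduct.map αHinv LinearMap.id) LinearMap.id ∘ₗ
    rearr k H M N ∘ₗ TensorProduct.map lM LinearMap.id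

/-- Quasi-braiding `m ⊗ n ↦ αN⁻¹(αH⁻¹(m₍₋₁₎)·n) ⊗ αM⁻¹(m₍₀₎)`. -/
def braidYD (αH : H ≃ₗ[k] H) (αM : M ≃ₗ[k] M) (αN : N ≃ₗ[k] N)
    (lM : M →ₗ[k] H ⊗[k] M) (ρN : H ⊗[k] N →ₗ[k] N) : M ⊗[k] N →ₗ[k] N ⊗[k] M :=
  TensorProduct.map
      (αN.symm.toLinearMap ∘ₗ ρN ∘ₗ TensorProduct.map αH.symm.toLinearMap LinearMap.id)
      αM.symm.toLinearMap ∘ₗ rearr k H M N ∘ₗ TensorProduct.map lM LinearMap.id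

/-- Action on `M ⊗ N`: `h ⊗ (m ⊗ n) ↦ h₁·m ⊗ h₂·n`. -/
def hatAction (Δ : H →ₗ[k] H ⊗[k] H)
    (ρM : H ⊗[k] M →ₗ[k] M) (ρN : H ⊗[k] N →ₗ[k] N) :
    H ⊗[k] (M ⊗[k] N) →ₗ[k] M ⊗[k] N :=
  TensorProduct.map ρM ρN ∘ₗ ttc k H H M N ∘ₗ TensorProduct.map Δ LinearMap.id

/-- Coaction on `M ⊗ N`: `m ⊗ n ↦ αHinv²(m₍₋₁₎ n₍₋₁₎) ⊗ (m₍₀₎ ⊗ n₍₀₎)`. -/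
def hatCoaction (μ : H ⊗[k] H →ₗ[k] H) (αHinv : H →ₗ[k] H)
    (lM : M →ₗ[k] H ⊗[k] M) (lN : N →ₗ[k] H ⊗[k] N) :
    M ⊗[k] N →ₗ[k] H ⊗[k] (M ⊗[k] N) :=
  TensorProduct.map (αHinv ∘ₗ αHinv ∘ₗ μ) LinearMap.id ∘ₗ ttc k H M H N ∘ₗ
    TensorProduct.map lM lN

/-- Action on `M ⊗ N`: `h ⊗ (m ⊗ n) ↦ αHinv²(h₁)·m ⊗ αHinv²(h₂)·n`. -/
def tildeAction (Δ : H →ₗ[k] H ⊗[k] H) (αHinv : H →ₗ[k] H)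
    (ρM : H ⊗[k] M →ₗ[k] M) (ρN : H ⊗[k] N →ₗ[k] N) :
    H ⊗[k] (M ⊗[k] N) →ₗ[k] M ⊗[k] N :=
  TensorProduct.map ρM ρN ∘ₗ ttc k H H M N ∘ₗ
    TensorProduct.map
      (TensorProduct.map (αHinv ∘ₗ αHinv) (αHinv ∘ₗ αHinv) ∘ₗ Δ) LinearMap.id

/-- Coaction on `M ⊗ N`: `m ⊗ n ↦ m₍₋₁₎ n₍₋₁₎ ⊗ (m₍₀₎ ⊗ n₍₀₎)`. -/
def tildeCoaction (μ : H ⊗[k] H →ₗ[k] H)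
    (lM : M →ₗ[k] H ⊗[k] M) (lN : N →ₗ[k] H ⊗[k] N) :
    M ⊗[k] N →ₗ[k] H ⊗[k] (M ⊗[k] N) :=
  TensorProduct.map μ LinearMap.id ∘ₗ ttc k H M H N ∘ₗ TensorProduct.map lM lN

/-- Associator `(x ⊗ y) ⊗ z ↦ αX⁻¹(x) ⊗ (y ⊗ αZ(z))`. -/
def aYD {X Z : Type*} [AddCommGroup X] [Module k X] [AddCommGroup Z] [Module k Z]
    (αX : X ≃ₗ[k] X) (Y : Type*) [AddCommGroup Y] [Module k Y] (αZ : Z ≃ₗ[k] Z) :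
    (X ⊗[k] Y) ⊗[k] Z →ₗ[k] X ⊗[k] (Y ⊗[k] Z) :=
  (TensorProduct.assoc k X Y Z).toLinearMap ∘ₗ
    TensorProduct.map (TensorProduct.map αX.symm.toLinearMap LinearMap.id) αZ.toLinearMap

/-- Inverse associator `x ⊗ (y ⊗ z) ↦ (αX(x) ⊗ y) ⊗ αZ⁻¹(z)`. -/
def aYDinv {X Z : Type*} [AddCommGroup X] [Module k X] [AddCommGroup Z] [Module k Z]
    (αX : X ≃ₗ[k] X) (Y : Type*) [AddCommGroup Y] [Module k Y] (αZ : Z ≃ₗ[k] Z) :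
    X ⊗[k] (Y ⊗[k] Z) →ₗ[k] (X ⊗[k] Y) ⊗[k] Z :=
  TensorProduct.map (TensorProduct.map αX.toLinearMap LinearMap.id) αZ.symm.toLinearMap ∘ₗ
    (TensorProduct.assoc k X Y Z).symm.toLinearMap

/-- Associator `(x ⊗ y) ⊗ z ↦ αX(x) ⊗ (y ⊗ αZ⁻¹(z))`. -/
def aTilde {X Z : Type*} [AddCommGroup X] [Module k X] [AddCommGroup Z] [Module k Z]
    (αX : X ≃ₗ[k] X) (Y : Type*) [AddCommGroup Y] [Module k Y] (αZ : Z ≃ₗ[k] Z) :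
    (X ⊗[k] Y) ⊗[k] Z →ₗ[k] X ⊗[k] (Y ⊗[k] Z) :=
  (TensorProduct.assoc k X Y Z).toLinearMap ∘ₗ
    TensorProduct.map (TensorProduct.map αX.toLinearMap LinearMap.id) αZ.symm.toLinearMap

/-- Inverse associator `x ⊗ (y ⊗ z) ↦ (αX⁻¹(x) ⊗ y) ⊗ αZ(z)`. -/
def aTildeInv {X Z : Type*} [AddCommGroup X] [Module k X] [AddCommGroup Z] [Module k Z]
    (αX : X ≃ₗ[k] X) (Y : Type*) [AddCommGroup Y] [Module k Y] (αZ : Z ≃ₗ[k] Z) :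
    X ⊗[k] (Y ⊗[k] Z) →ₗ[k] (X ⊗[k] Y) ⊗[k] Z :=
  TensorProduct.map (TensorProduct.map αX.symm.toLinearMap LinearMap.id) αZ.toLinearMap ∘ₗ
    (TensorProduct.assoc k X Y Z).symm.toLinearMap

/-- Quasitriangular Hom-bialgebra. -/
def IsQuasitriangular (μ : H ⊗[k] H →ₗ[k] H) (Δ : H →ₗ[k] H ⊗[k] H) (α : H →ₗ[k] H)
    (R : H ⊗[k] H) : Prop :=
  IsHomBialgebra k μ Δ α ∧
  TensorProduct.map Δ α R
    = TensorProduct.map (TensorProduct.map α α) μ (ttc k H H H H (R ⊗ₜ[k] R)) ∧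
  TensorProduct.map α Δ R
    = TensorProduct.map μ (TensorProduct.map α α ∘ₗ (TensorProduct.comm k H H).toLinearMap)
        (ttc k H H H H (R ⊗ₜ[k] R)) ∧
  ∀ h : H, TensorProduct.map μ μ (ttc k H H H H ((TensorProduct.comm k H H (Δ h)) ⊗ₜ[k] R))
      = TensorProduct.map μ μ (ttc k H H H H (R ⊗ₜ[k] Δ h))

/-- Coaction induced by an R-matrix: `m ↦ α(R²) ⊗ R¹·m`. -/
def coactionFromR (R : H ⊗[k] H) (α : H →ₗ[k] H) (ρM : H ⊗[k] M →ₗ[k] M) :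
    M →ₗ[k] H ⊗[k] M :=
  (TensorProduct.comm k M H).toLinearMap ∘ₗ TensorProduct.map ρM α ∘ₗ rearr k H H M ∘ₗ
    TensorProduct.mk k (H ⊗[k] H) M R

/-- Quasi-braiding from an R-matrix: `m ⊗ n ↦ αN⁻¹(R²·n) ⊗ αM⁻¹(R¹·m)`. -/
def braidR (R : H ⊗[k] H) (ρM : H ⊗[k] M →ₗ[k] M) (ρN : H ⊗[k] N →ₗ[k] N)
    (αM : M ≃ₗ[k] M) (αN : N ≃ₗ[k] N) : M ⊗[k] N →ₗ[k] N ⊗[k] M :=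
  TensorProduct.map αN.symm.toLinearMap αM.symm.toLinearMap ∘ₗ
    (TensorProduct.comm k M N).toLinearMap ∘ₗ TensorProduct.map ρM ρN ∘ₗ
      ttc k H H M N ∘ₗ TensorProduct.mk k (H ⊗[k] H) (M ⊗[k] N) R

/-- Coquasitriangular Hom-bialgebra. -/
def IsCoquasitriangular (μ : H ⊗[k] H →ₗ[k] H) (Δ : H →ₗ[k] H ⊗[k] H) (α : H →ₗ[k] H)
    (σ : H ⊗[k] H →ₗ[k] k) : Prop :=
  IsHomBialgebra k μ Δ α ∧
  (∀ x y z : H, σ (μ (x ⊗ₜ[k] y) ⊗ₜ[k] α z)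
      = LinearMap.mul' k k
          (TensorProduct.map σ σ (ttc k H H H H ((α x ⊗ₜ[k] α y) ⊗ₜ[k] Δ z)))) ∧
  (∀ x y z : H, σ (α x ⊗ₜ[k] μ (y ⊗ₜ[k] z))
      = LinearMap.mul' k k
          (TensorProduct.map σ σ (ttc k H H H H (Δ x ⊗ₜ[k] (α z ⊗ₜ[k] α y))))) ∧
  (∀ x y : H,
      (TensorProduct.rid k H)
        (TensorProduct.map (μ ∘ₗ (TensorProduct.comm k H H).toLinearMap) σ
          (ttc k H H H H (Δ x ⊗ₜ[k] Δ y)))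
      = (TensorProduct.lid k H)
          (TensorProduct.map σ μ (ttc k H H H H (Δ x ⊗ₜ[k] Δ y))))

/-- Action induced by a coquasitriangular form: `h ⊗ m ↦ σ(m₍₋₁₎ ⊗ α(h)) • m₍₀₎`. -/
def actionFromSigma (σ : H ⊗[k] H →ₗ[k] k) (α : H →ₗ[k] H)
    (lM : M →ₗ[k] H ⊗[k] M) : H ⊗[k] M →ₗ[k] M :=
  (TensorProduct.lid k M).toLinearMap ∘ₗ
    TensorProduct.map (σ ∘ₗ TensorProduct.map LinearMap.id α ∘ₗ
        (TensorProduct.comm k H H).toLinearMap) LinearMap.id ∘ₗ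
      (TensorProduct.assoc k H H M).symm.toLinearMap ∘ₗ
        TensorProduct.map LinearMap.id lM

/-- Quasi-braiding from a coquasitriangular form:
`m ⊗ n ↦ σ(n₍₋₁₎ ⊗ m₍₋₁₎) • (αN⁻¹(n₍₀₎) ⊗ αM⁻¹(m₍₀₎))`. -/
def braidSigma (σ : H ⊗[k] H →ₗ[k] k)
    (lM : M →ₗ[k] H ⊗[k] M) (lN : N →ₗ[k] H ⊗[k] N)
    (αM : M ≃ₗ[k] M) (αN : N ≃ₗ[k] N) : M ⊗[k] N →ₗ[k] N ⊗[k] M :=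
  (TensorProduct.lid k (N ⊗[k] M)).toLinearMap ∘ₗ
    TensorProduct.map (σ ∘ₗ (TensorProduct.comm k H H).toLinearMap)
      (TensorProduct.map αN.symm.toLinearMap αM.symm.toLinearMap ∘ₗ
        (TensorProduct.comm k M N).toLinearMap) ∘ₗ
      ttc k H M H N ∘ₗ TensorProduct.map lM lN

section Auxiliary

variable {k}
variable {P X Y : Type*}
variable [AddCommGroup P] [Module k P] [AddCommGroup X] [Module k X] [AddCommGroup Y] [Module k Y]

@[simp]
theorem ttc_tmul (a : H) (b : M) (c : N) (d : P) :
    ttc k H M N P ((a ⊗ₜ[k] b) ⊗ₜ[k] (c ⊗ₜ[k] d)) = (a ⊗ₜ c) ⊗ₜ (b ⊗ₜ d) := rfl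

theorem braidSigma_tmul (σ : H ⊗[k] H →ₗ[k] k) (lM : M →ₗ[k] H ⊗[k] M) (lN : N →ₗ[k] H ⊗[k] N)
    (αM : M ≃ₗ[k] M) (αN : N ≃ₗ[k] N) (m : M) (n : N) :
    braidSigma k σ lM lN αM αN (m ⊗ₜ n) =
      TensorProduct.lid k (N ⊗[k] M)
        (TensorProduct.map (σ ∘ₗ (TensorProduct.comm k H H).toLinearMap)
          (TensorProduct.map αN.symm.toLinearMap αM.symm.toLinearMap ∘ₗ
            (TensorProduct.comm k M N).toLinearMap) (ttc k H M H N (lM m ⊗ₜ lN n))) := rfl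

theorem tildeCoaction_tmul (μ : H ⊗[k] H →ₗ[k] H) (lM : M →ₗ[k] H ⊗[k] M)
    (lN : N →ₗ[k] H ⊗[k] N) (m : M) (n : N) :
    tildeCoaction k μ lM lN (m ⊗ₜ n) =
      TensorProduct.map μ LinearMap.id (ttc k H M H N (lM m ⊗ₜ lN n)) := rfl

theorem aTilde_tmul (αX : X ≃ₗ[k] X) (αY : Y ≃ₗ[k] Y) (x : X) (m : M) (y : Y) :
    aTilde k αX M αY ((x ⊗ₜ m) ⊗ₜ y) = αX x ⊗ₜ (m ⊗ₜ αY.symm y) := rfl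

theorem aTildeInv_tmul (αX : X ≃ₗ[k] X) (αY : Y ≃ₗ[k] Y) (x : X) (m : M) (y : Y) :
    aTildeInv k αX M αY (x ⊗ₜ (m ⊗ₜ y)) = (αX.symm x ⊗ₜ m) ⊗ₜ αY y := rfl

theorem aTilde_aTildeInv (αX : X ≃ₗ[k] X) (αY : Y ≃ₗ[k] Y) (t : X ⊗[k] (M ⊗[k] Y)) :
    aTilde k αX M αY (aTildeInv k αX M αY t) = t := by
  have h : aTilde k αX M αY ∘ₗ aTildeInv k αX M αY = LinearMap.id := by
    ext x m y
    simp [aTilde_tmul, aTildeInv_tmul]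
  exact LinearMap.congr_fun h t

theorem aTildeInv_aTilde (αX : X ≃ₗ[k] X) (αY : Y ≃ₗ[k] Y) (t : (X ⊗[k] M) ⊗[k] Y) :
    aTildeInv k αX M αY (aTilde k αX M αY t) = t := by
  have h : aTildeInv k αX M αY ∘ₗ aTilde k αX M αY = LinearMap.id := by
    ext x m y
    simp [aTilde_tmul, aTildeInv_tmul]
  exact LinearMap.congr_fun h t

namespace IsHomComodule

variable {Δ : H →ₗ[k] H ⊗[k] H} {αH : H ≃ₗ[k] H} {lM : M →ₗ[k] H ⊗[k] M} {αM : M ≃ₗ[k] M}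

theorem coact_map (hM : IsHomComodule k Δ αH.toLinearMap lM αM.toLinearMap) (m : M) :
    lM (αM m) = TensorProduct.map αH.toLinearMap αM.toLinearMap (lM m) :=
  (LinearMap.congr_fun hM.str_compat m).symm

theorem coact_symm (hM : IsHomComodule k Δ αH.toLinearMap lM αM.toLinearMap) (m : M) :
    lM (αM.symm m) = TensorProduct.map αH.symm.toLinearMap αM.symm.toLinearMap (lM m) := by
  have h := hM.coact_map (αM.symm m)
  rw [LinearEquiv.apply_symm_apply] at h
  rw [h, ← LinearMap.comp_apply, ← TensorProduct.map_comp]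
  simp

theorem coact_coact (hM : IsHomComodule k Δ αH.toLinearMap lM αM.toLinearMap) (m : M) :
    TensorProduct.map Δ αM.toLinearMap (lM m) =
      (TensorProduct.assoc k H H M).symm (TensorProduct.map αH.toLinearMap lM (lM m)) :=
  LinearMap.congr_fun hM.hom_coact m

end IsHomComodule

variable {μ : H ⊗[k] H →ₗ[k] H} {Δ : H →ₗ[k] H ⊗[k] H} {αH : H ≃ₗ[k] H}
  {σ : H ⊗[k] H →ₗ[k] k}
  {lM : M →ₗ[k] H ⊗[k] M} {αM : M ≃ₗ[k] M} {lN : N →ₗ[k] H ⊗[k] N} {αN : N ≃ₗ[k] N}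
  {lP : P →ₗ[k] H ⊗[k] P} {αP : P ≃ₗ[k] P}

/-- A coquasitriangular form that is invariant under the structure map braids equivariantly. -/
theorem braidSigma_map
    (hσ : σ ∘ₗ TensorProduct.map αH.toLinearMap αH.toLinearMap = σ)
    (hM : IsHomComodule k Δ αH.toLinearMap lM αM.toLinearMap)
    (hN : IsHomComodule k Δ αH.toLinearMap lN αN.toLinearMap) :
    TensorProduct.map αN.toLinearMap αM.toLinearMap ∘ₗ braidSigma k σ lM lN αM αN
      = braidSigma k σ lM lN αM αN ∘ₗ TensorProduct.map αM.toLinearMap αN.toLinearMap := by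
  have hσ' (x y : H) : σ (αH x ⊗ₜ αH y) = σ (x ⊗ₜ y) := LinearMap.congr_fun hσ (x ⊗ₜ y)
  ext m n
  simp only [TensorProduct.AlgebraTensorModule.curry_apply, LinearMap.restrictScalars_self,
    TensorProduct.curry_apply, LinearMap.comp_apply, TensorProduct.map_tmul,
    LinearEquiv.coe_coe, braidSigma_tmul, hM.coact_map, hN.coact_map]
  generalize lM m = t
  generalize lN n = u
  induction t with
  | zero => simp
  | add _ _ h₁ h₂ => simp only [TensorProduct.add_tmul, map_add, h₁, h₂]
  | tmul a m =>
    induction u with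
    | zero => simp
    | add _ _ h₁ h₂ => simp only [TensorProduct.tmul_add, map_add, h₁, h₂]
    | tmul b n => simp [hσ']

theorem braidSigma_natural {lX : X →ₗ[k] H ⊗[k] X} {αX : X ≃ₗ[k] X}
    {lY : Y →ₗ[k] H ⊗[k] Y} {αY : Y ≃ₗ[k] Y} (f : X →ₗ[k] Y)
    (hl : TensorProduct.map LinearMap.id f ∘ₗ lX = lY ∘ₗ f)
    (hα : f ∘ₗ αX.toLinearMap = αY.toLinearMap ∘ₗ f) (t : M ⊗[k] X) :
    TensorProduct.map f LinearMap.id (braidSigma k σ lM lX αM αX t) =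
      braidSigma k σ lM lY αM αY (TensorProduct.map LinearMap.id f t) := by
  have hα' (x : X) : f (αX.symm x) = αY.symm (f x) := by
    rw [LinearEquiv.eq_symm_apply]
    simpa using (LinearMap.congr_fun hα (αX.symm x)).symm
  have hl' (x : X) : lY (f x) = TensorProduct.map LinearMap.id f (lX x) :=
    (LinearMap.congr_fun hl x).symm
  induction t with
  | zero => simp
  | add _ _ h₁ h₂ => simp only [map_add, h₁, h₂]
  | tmul m x =>
    simp only [TensorProduct.map_tmul, LinearMap.id_apply, braidSigma_tmul, hl']
    generalize lM m = t
    generalize lX x = u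
    induction t with
    | zero => simp
    | add _ _ h₁ h₂ => simp only [TensorProduct.add_tmul, map_add, h₁, h₂]
    | tmul a m =>
      induction u with
      | zero => simp
      | add _ _ h₁ h₂ => simp only [TensorProduct.tmul_add, map_add, h₁, h₂]
      | tmul b n => simp [hα']

theorem braidSigma_colinear
    (hCQT : IsCoquasitriangular k μ Δ αH.toLinearMap σ)
    (hσ : σ ∘ₗ TensorProduct.map αH.toLinearMap αH.toLinearMap = σ)
    (hM : IsHomComodule k Δ αH.toLinearMap lM αM.toLinearMap)
    (hN : IsHomComodule k Δ αH.toLinearMap lN αN.toLinearMap) :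
    TensorProduct.map (LinearMap.id : H →ₗ[k] H) (braidSigma k σ lM lN αM αN) ∘ₗ
        tildeCoaction k μ lM lN
      = tildeCoaction k μ lN lM ∘ₗ braidSigma k σ lM lN αM αN := by
  obtain ⟨hH, -, -, hcomm⟩ := hCQT
  have hσ' (x y : H) : σ (αH x ⊗ₜ αH y) = σ (x ⊗ₜ y) := LinearMap.congr_fun hσ (x ⊗ₜ y)
  have hμ (x y : H) : αH (μ (x ⊗ₜ y)) = μ (αH x ⊗ₜ αH y) := hH.mul_mult x y
  let G (K : (H ⊗[k] H) ⊗[k] (H ⊗[k] H) →ₗ[k] H) :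
      ((H ⊗[k] H) ⊗[k] N) ⊗[k] ((H ⊗[k] H) ⊗[k] M) →ₗ[k] H ⊗[k] (N ⊗[k] M) :=
    TensorProduct.map K (TensorProduct.map αN.symm.toLinearMap αM.symm.toLinearMap) ∘ₗ
      ttc k (H ⊗[k] H) N (H ⊗[k] H) M
  let K₁ : (H ⊗[k] H) ⊗[k] (H ⊗[k] H) →ₗ[k] H :=
    (TensorProduct.rid k H).toLinearMap ∘ₗ
      TensorProduct.map (μ ∘ₗ (TensorProduct.comm k H H).toLinearMap) σ ∘ₗ ttc k H H H H
  let K₂ : (H ⊗[k] H) ⊗[k] (H ⊗[k] H) →ₗ[k] H :=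
    (TensorProduct.lid k H).toLinearMap ∘ₗ TensorProduct.map σ μ ∘ₗ ttc k H H H H
  have hK (x y : H) : K₁ (Δ x ⊗ₜ Δ y) = K₂ (Δ x ⊗ₜ Δ y) := hcomm x y
  have hG (u : H ⊗[k] N) (t : H ⊗[k] M) :
      G K₁ (TensorProduct.map Δ αN.toLinearMap u ⊗ₜ TensorProduct.map Δ αM.toLinearMap t) =
        G K₂ (TensorProduct.map Δ αN.toLinearMap u ⊗ₜ
          TensorProduct.map Δ αM.toLinearMap t) := by
    induction t with
    | zero => simp
    | add _ _ h₁ h₂ => simp only [TensorProduct.tmul_add, map_add, h₁, h₂]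
    | tmul a m =>
      induction u with
      | zero => simp
      | add _ _ h₁ h₂ => simp only [TensorProduct.add_tmul, map_add, h₁, h₂]
      | tmul b n => simp [G, hK]
  have hinj : Function.Injective
      (TensorProduct.congr αH (LinearEquiv.refl k (N ⊗[k] M))) := LinearEquiv.injective _
  ext m n
  apply hinj
  refine Eq.trans ?_ ((hG (lN n) (lM m)).trans ?_)
  · rw [hM.coact_coact, hN.coact_coact]
    simp only [TensorProduct.AlgebraTensorModule.curry_apply, LinearMap.restrictScalars_self,
      TensorProduct.curry_apply, LinearMap.comp_apply, tildeCoaction_tmul]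
    generalize lM m = t
    generalize lN n = u
    induction t with
    | zero => simp
    | add _ _ h₁ h₂ => simp only [TensorProduct.add_tmul, TensorProduct.tmul_add, map_add, h₁, h₂]
    | tmul a m =>
      induction u with
      | zero => simp
      | add _ _ h₁ h₂ =>
        simp only [TensorProduct.add_tmul, TensorProduct.tmul_add, map_add, h₁, h₂]
      | tmul b n =>
        simp only [ttc_tmul, TensorProduct.map_tmul, braidSigma_tmul, LinearMap.id_apply]
        generalize lM m = t
        generalize lN n = u
        induction t with
        | zero => simp
        | add _ _ h₁ h₂ =>
          simp only [TensorProduct.add_tmul, TensorProduct.tmul_add, map_add, h₁, h₂]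
        | tmul c m =>
          induction u with
          | zero => simp
          | add _ _ h₁ h₂ =>
            simp only [TensorProduct.add_tmul, TensorProduct.tmul_add, map_add, h₁, h₂]
          | tmul d n => simp [G, K₁, hμ, ← TensorProduct.smul_tmul']
  · rw [hM.coact_coact, hN.coact_coact]
    simp only [TensorProduct.AlgebraTensorModule.curry_apply, LinearMap.restrictScalars_self,
      TensorProduct.curry_apply, LinearMap.comp_apply, braidSigma_tmul]
    generalize lM m = t
    generalize lN n = u
    induction t with
    | zero => simp
    | add _ _ h₁ h₂ => simp only [TensorProduct.add_tmul, TensorProduct.tmul_add, map_add, h₁, h₂]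
    | tmul a m =>
      induction u with
      | zero => simp
      | add _ _ h₁ h₂ =>
        simp only [TensorProduct.add_tmul, TensorProduct.tmul_add, map_add, h₁, h₂]
      | tmul b n =>
        simp only [ttc_tmul, TensorProduct.map_tmul, LinearMap.comp_apply, LinearEquiv.coe_coe,
          TensorProduct.comm_tmul, TensorProduct.lid_tmul, map_smul, tildeCoaction_tmul,
          hM.coact_symm, hN.coact_symm]
        generalize lM m = t
        generalize lN n = u
        induction t with
        | zero => simp
        | add _ _ h₁ h₂ =>
          simp only [TensorProduct.tmul_add, map_add, smul_add, h₁, h₂]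
        | tmul c m =>
          induction u with
          | zero => simp
          | add _ _ h₁ h₂ =>
            simp only [TensorProduct.add_tmul, TensorProduct.tmul_add, map_add, smul_add, h₁, h₂]
          | tmul d n => simp [G, K₂, hμ, hσ', TensorProduct.smul_tmul']

theorem braidSigma_hexagon
    (hCQT : IsCoquasitriangular k μ Δ αH.toLinearMap σ)
    (hσ : σ ∘ₗ TensorProduct.map αH.toLinearMap αH.toLinearMap = σ)
    (hM : IsHomComodule k Δ αH.toLinearMap lM αM.toLinearMap)
    (hP : IsHomComodule k Δ αH.toLinearMap lP αP.toLinearMap) :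
    aTilde k αN P αM ∘ₗ
        braidSigma k σ lM (tildeCoaction k μ lN lP) αM (TensorProduct.congr αN αP) ∘ₗ
          aTilde k αM N αP
      = TensorProduct.map (LinearMap.id : N →ₗ[k] N) (braidSigma k σ lM lP αM αP) ∘ₗ
          aTilde k αN M αP ∘ₗ
            TensorProduct.map (braidSigma k σ lM lN αM αN) (LinearMap.id : P →ₗ[k] P) := by
  obtain ⟨-, hmul, -, -⟩ := hCQT
  have hσ' (x y : H) : σ (αH x ⊗ₜ αH y) = σ (x ⊗ₜ y) := LinearMap.congr_fun hσ (x ⊗ₜ y)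
  have hσs (x y : H) : σ (x ⊗ₜ αH.symm y) = σ (αH x ⊗ₜ y) := by
    rw [← hσ' x, LinearEquiv.apply_symm_apply]
  have hσss (x y : H) : σ (αH.symm x ⊗ₜ αH.symm y) = σ (x ⊗ₜ y) := by
    rw [hσs, LinearEquiv.apply_symm_apply]
  have hmul' (x y z : H) : σ (μ (x ⊗ₜ y) ⊗ₜ αH z) = LinearMap.mul' k k
      (TensorProduct.map σ σ (ttc k H H H H ((αH x ⊗ₜ αH y) ⊗ₜ Δ z))) := hmul x y z
  let G : ((H ⊗[k] H) ⊗[k] M) ⊗[k] ((H ⊗[k] H) ⊗[k] (N ⊗[k] P)) →ₗ[k] N ⊗[k] (P ⊗[k] M) :=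
    (TensorProduct.lid k _).toLinearMap ∘ₗ
      TensorProduct.map
        (LinearMap.mul' k k ∘ₗ
          TensorProduct.map
            (σ ∘ₗ TensorProduct.map αH.toLinearMap LinearMap.id ∘ₗ
              (TensorProduct.comm k H H).toLinearMap)
            (σ ∘ₗ (TensorProduct.comm k H H).toLinearMap) ∘ₗ ttc k H H H H)
        (TensorProduct.map LinearMap.id
            (TensorProduct.map (αP.symm.toLinearMap ∘ₗ αP.symm.toLinearMap)
              (αM.symm.toLinearMap ∘ₗ αM.symm.toLinearMap)) ∘ₗ
          (TensorProduct.assoc k N P M).toLinearMap ∘ₗ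
          (TensorProduct.comm k M (N ⊗[k] P)).toLinearMap) ∘ₗ
      ttc k (H ⊗[k] H) M (H ⊗[k] H) (N ⊗[k] P)
  ext m n p
  trans G (TensorProduct.map Δ αM.toLinearMap (lM m) ⊗ₜ ttc k H N H P (lN n ⊗ₜ lP p))
  · simp only [TensorProduct.AlgebraTensorModule.curry_apply, LinearMap.restrictScalars_self,
      TensorProduct.curry_apply, LinearMap.comp_apply, aTilde_tmul,
      braidSigma_tmul, tildeCoaction_tmul, hM.coact_map, hP.coact_symm]
    generalize lM m = t
    generalize lN n = u
    generalize lP p = v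
    induction t with
    | zero => simp
    | add _ _ h₁ h₂ => simp only [TensorProduct.add_tmul, map_add, h₁, h₂]
    | tmul a m =>
      induction u with
      | zero => simp
      | add _ _ h₁ h₂ => simp only [TensorProduct.add_tmul, TensorProduct.tmul_add, map_add, h₁, h₂]
      | tmul b n =>
        induction v with
        | zero => simp
        | add _ _ h₁ h₂ => simp only [TensorProduct.tmul_add, map_add, h₁, h₂]
        | tmul c p =>
          simp only [ttc_tmul, TensorProduct.map_tmul, LinearMap.comp_apply,
            LinearEquiv.coe_coe, TensorProduct.comm_tmul, LinearMap.id_apply, hmul']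
          generalize Δ a = w
          induction w with
          | zero => simp
          | add _ _ h₁ h₂ =>
            simp only [TensorProduct.add_tmul, TensorProduct.tmul_add, map_add, h₁, h₂]
          | tmul x y => simp [G, aTilde_tmul]
  · rw [hM.coact_coact]
    simp only [TensorProduct.AlgebraTensorModule.curry_apply, LinearMap.restrictScalars_self,
      TensorProduct.curry_apply, LinearMap.comp_apply, TensorProduct.map_tmul,
      braidSigma_tmul, LinearMap.id_apply]
    generalize lM m = t
    generalize lN n = u
    induction t with
    | zero => simp
    | add _ _ h₁ h₂ => simp only [TensorProduct.add_tmul, map_add, h₁, h₂]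
    | tmul a m =>
      induction u with
      | zero => simp
      | add _ _ h₁ h₂ => simp only [TensorProduct.add_tmul, TensorProduct.tmul_add, map_add, h₁, h₂]
      | tmul b n =>
        simp only [ttc_tmul, TensorProduct.map_tmul, LinearMap.comp_apply, LinearEquiv.coe_coe,
          TensorProduct.comm_tmul, TensorProduct.lid_tmul, TensorProduct.smul_tmul', map_smul,
          aTilde_tmul, LinearMap.id_apply, braidSigma_tmul, hM.coact_symm, hP.coact_symm]
        generalize lM m = t
        generalize lP p = v
        induction t with
        | zero => simp
        | add _ _ h₁ h₂ =>
          simp only [TensorProduct.add_tmul, TensorProduct.tmul_add, map_add, h₁, h₂]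
        | tmul c m =>
          induction v with
          | zero => simp
          | add _ _ h₁ h₂ =>
            simp only [TensorProduct.tmul_add, map_add, h₁, h₂]
          | tmul d p => simp [G, hσ', hσss, smul_smul, mul_comm, ← TensorProduct.smul_tmul']

theorem braidSigma_hexagon_inv
    (hCQT : IsCoquasitriangular k μ Δ αH.toLinearMap σ)
    (hσ : σ ∘ₗ TensorProduct.map αH.toLinearMap αH.toLinearMap = σ)
    (hM : IsHomComodule k Δ αH.toLinearMap lM αM.toLinearMap)
    (hP : IsHomComodule k Δ αH.toLinearMap lP αP.toLinearMap) :
    aTildeInv k αP M αN ∘ₗ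
        braidSigma k σ (tildeCoaction k μ lM lN) lP (TensorProduct.congr αM αN) αP ∘ₗ
          aTildeInv k αM N αP
      = TensorProduct.map (braidSigma k σ lM lP αM αP) (LinearMap.id : N →ₗ[k] N) ∘ₗ
          aTildeInv k αM P αN ∘ₗ
            TensorProduct.map (LinearMap.id : M →ₗ[k] M) (braidSigma k σ lN lP αN αP) := by
  obtain ⟨-, -, hmul, -⟩ := hCQT
  have hσ' (x y : H) : σ (αH x ⊗ₜ αH y) = σ (x ⊗ₜ y) := LinearMap.congr_fun hσ (x ⊗ₜ y)
  have hσss (x y : H) : σ (αH.symm x ⊗ₜ αH.symm y) = σ (x ⊗ₜ y) := by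
    rw [← hσ', LinearEquiv.apply_symm_apply, LinearEquiv.apply_symm_apply]
  have hmul' (x y z : H) : σ (αH x ⊗ₜ μ (y ⊗ₜ z)) = LinearMap.mul' k k
      (TensorProduct.map σ σ (ttc k H H H H (Δ x ⊗ₜ (αH z ⊗ₜ αH y)))) := hmul x y z
  let G : ((H ⊗[k] H) ⊗[k] P) ⊗[k] ((H ⊗[k] H) ⊗[k] (N ⊗[k] M)) →ₗ[k] (P ⊗[k] M) ⊗[k] N :=
    (TensorProduct.lid k _).toLinearMap ∘ₗ
      TensorProduct.map
        (LinearMap.mul' k k ∘ₗ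
          TensorProduct.map (σ ∘ₗ TensorProduct.map LinearMap.id αH.toLinearMap) σ ∘ₗ
            ttc k H H H H)
        ((TensorProduct.assoc k P M N).symm.toLinearMap ∘ₗ
          TensorProduct.map (αP.symm.toLinearMap ∘ₗ αP.symm.toLinearMap)
            (TensorProduct.map (αM.symm.toLinearMap ∘ₗ αM.symm.toLinearMap) LinearMap.id ∘ₗ
              (TensorProduct.comm k N M).toLinearMap)) ∘ₗ
      ttc k (H ⊗[k] H) P (H ⊗[k] H) (N ⊗[k] M)
  ext m n p
  trans G (TensorProduct.map Δ αP.toLinearMap (lP p) ⊗ₜ ttc k H N H M (lN n ⊗ₜ lM m))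
  · simp only [TensorProduct.AlgebraTensorModule.curry_apply, LinearMap.restrictScalars_self,
      TensorProduct.curry_apply, LinearMap.comp_apply, aTildeInv_tmul,
      braidSigma_tmul, tildeCoaction_tmul, hP.coact_map, hM.coact_symm]
    generalize lM m = t
    generalize lN n = u
    generalize lP p = v
    induction t with
    | zero => simp
    | add _ _ h₁ h₂ => simp only [TensorProduct.add_tmul, TensorProduct.tmul_add, map_add, h₁, h₂]
    | tmul a m =>
      induction u with
      | zero => simp
      | add _ _ h₁ h₂ => simp only [TensorProduct.add_tmul, TensorProduct.tmul_add, map_add, h₁, h₂]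
      | tmul b n =>
        induction v with
        | zero => simp
        | add _ _ h₁ h₂ => simp only [TensorProduct.add_tmul, TensorProduct.tmul_add, map_add, h₁, h₂]
        | tmul c p =>
          simp only [ttc_tmul, TensorProduct.map_tmul, LinearMap.comp_apply,
            LinearEquiv.coe_coe, TensorProduct.comm_tmul, LinearMap.id_apply, hmul']
          generalize Δ c = w
          induction w with
          | zero => simp
          | add _ _ h₁ h₂ =>
            simp only [TensorProduct.add_tmul, map_add, h₁, h₂]
          | tmul x y => simp [G, aTildeInv_tmul, TensorProduct.smul_tmul']
  · rw [hP.coact_coact]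
    simp only [TensorProduct.AlgebraTensorModule.curry_apply, LinearMap.restrictScalars_self,
      TensorProduct.curry_apply, LinearMap.comp_apply, TensorProduct.map_tmul,
      braidSigma_tmul, LinearMap.id_apply]
    generalize lP p = t
    generalize lN n = u
    induction t with
    | zero => simp
    | add _ _ h₁ h₂ => simp only [TensorProduct.add_tmul, TensorProduct.tmul_add, map_add, h₁, h₂]
    | tmul a p =>
      induction u with
      | zero => simp
      | add _ _ h₁ h₂ => simp only [TensorProduct.add_tmul, TensorProduct.tmul_add, map_add, h₁, h₂]
      | tmul b n =>
        simp only [ttc_tmul, TensorProduct.map_tmul, LinearMap.comp_apply, LinearEquiv.coe_coe,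
          TensorProduct.comm_tmul, TensorProduct.lid_tmul, TensorProduct.tmul_smul, map_smul,
          aTildeInv_tmul, LinearMap.id_apply, braidSigma_tmul, hM.coact_symm, hP.coact_symm]
        generalize lM m = t
        generalize lP p = v
        induction t with
        | zero => simp
        | add _ _ h₁ h₂ =>
          simp only [TensorProduct.add_tmul, TensorProduct.tmul_add, map_add, smul_add, h₁, h₂]
        | tmul c m =>
          induction v with
          | zero => simp
          | add _ _ h₁ h₂ =>
            simp only [TensorProduct.add_tmul, TensorProduct.tmul_add, map_add, smul_add, h₁, h₂]
          | tmul d p => simp [G, hσ', hσss, mul_smul, TensorProduct.smul_tmul']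

/-- In the composite of three braidings the structure map of the strand that crosses the other two
cancels against the associators. -/
theorem aTilde_braid_left (αX : X ≃ₗ[k] X) (αM : M ≃ₗ[k] M) (αY : Y ≃ₗ[k] Y)
    (c : X ⊗[k] M →ₗ[k] M ⊗[k] X) (d : X ⊗[k] Y →ₗ[k] Y ⊗[k] X)
    (x : X) (m : M) (y : Y) :
    aTildeInv k αM Y αX (TensorProduct.map LinearMap.id d (aTilde k αM X αY
        (TensorProduct.map c LinearMap.id (aTildeInv k αX M αY (αX x ⊗ₜ (m ⊗ₜ y)))))) =
      TensorProduct.map LinearMap.id αX.toLinearMap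
        ((TensorProduct.assoc k M Y X).symm (TensorProduct.map LinearMap.id d
          (TensorProduct.assoc k M X Y (c (x ⊗ₜ m) ⊗ₜ y)))) := by
  simp only [aTildeInv_tmul, TensorProduct.map_tmul, LinearEquiv.symm_apply_apply,
    LinearMap.id_apply]
  generalize c (x ⊗ₜ m) = t
  induction t with
  | zero => simp
  | add _ _ h₁ h₂ => simp only [TensorProduct.add_tmul, map_add, h₁, h₂]
  | tmul m x =>
    simp only [aTilde_tmul, TensorProduct.map_tmul, LinearEquiv.symm_apply_apply,
      LinearMap.id_apply, TensorProduct.assoc_tmul]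
    generalize d (x ⊗ₜ y) = t
    induction t with
    | zero => simp
    | add _ _ h₁ h₂ => simp only [TensorProduct.tmul_add, map_add, h₁, h₂]
    | tmul y x => simp [aTildeInv_tmul]

theorem braidSigma_braid
    (hCQT : IsCoquasitriangular k μ Δ αH.toLinearMap σ)
    (hσ : σ ∘ₗ TensorProduct.map αH.toLinearMap αH.toLinearMap = σ)
    (hM : IsHomComodule k Δ αH.toLinearMap lM αM.toLinearMap)
    (hN : IsHomComodule k Δ αH.toLinearMap lN αN.toLinearMap)
    (hP : IsHomComodule k Δ αH.toLinearMap lP αP.toLinearMap) :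
    TensorProduct.map (LinearMap.id : P →ₗ[k] P) (braidSigma k σ lM lN αM αN) ∘ₗ
        (TensorProduct.assoc k P M N).toLinearMap ∘ₗ
          TensorProduct.map (braidSigma k σ lM lP αM αP) (LinearMap.id : N →ₗ[k] N) ∘ₗ
            (TensorProduct.assoc k M P N).symm.toLinearMap ∘ₗ
              TensorProduct.map (LinearMap.id : M →ₗ[k] M) (braidSigma k σ lN lP αN αP)
      = (TensorProduct.assoc k P N M).toLinearMap ∘ₗ
          TensorProduct.map (braidSigma k σ lN lP αN αP) (LinearMap.id : M →ₗ[k] M) ∘ₗ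
            (TensorProduct.assoc k N P M).symm.toLinearMap ∘ₗ
              TensorProduct.map (LinearMap.id : N →ₗ[k] N) (braidSigma k σ lM lP αM αP) ∘ₗ
                (TensorProduct.assoc k N M P).toLinearMap ∘ₗ
                  TensorProduct.map (braidSigma k σ lM lN αM αN)
                    (LinearMap.id : P →ₗ[k] P) ∘ₗ
                    (TensorProduct.assoc k M N P).symm.toLinearMap := by
  have hNP (t) : braidSigma k σ lM (tildeCoaction k μ lN lP) αM (TensorProduct.congr αN αP) t =
      aTildeInv k αN P αM (TensorProduct.map LinearMap.id (braidSigma k σ lM lP αM αP)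
        (aTilde k αN M αP (TensorProduct.map (braidSigma k σ lM lN αM αN) LinearMap.id
          (aTildeInv k αM N αP t)))) := by
    have h := LinearMap.congr_fun (braidSigma_hexagon (lN := lN) (αN := αN) hCQT hσ hM hP)
      (aTildeInv k αM N αP t)
    simp only [LinearMap.comp_apply, aTilde_aTildeInv] at h
    rw [← h, aTildeInv_aTilde]
  have hPN (t) : braidSigma k σ lM (tildeCoaction k μ lP lN) αM (TensorProduct.congr αP αN) t =
      aTildeInv k αP N αM (TensorProduct.map LinearMap.id (braidSigma k σ lM lN αM αN)
        (aTilde k αP M αN (TensorProduct.map (braidSigma k σ lM lP αM αP) LinearMap.id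
          (aTildeInv k αM P αN t)))) := by
    have h := LinearMap.congr_fun (braidSigma_hexagon (lN := lP) (αN := αP) hCQT hσ hM hN)
      (aTildeInv k αM P αN t)
    simp only [LinearMap.comp_apply, aTilde_aTildeInv] at h
    rw [← h, aTildeInv_aTilde]
  have hinj : Function.Injective (TensorProduct.map
      (LinearMap.id : P ⊗[k] N →ₗ[k] P ⊗[k] N) αM.toLinearMap) :=
    (TensorProduct.congr (LinearEquiv.refl k (P ⊗[k] N)) αM).injective
  ext m n p
  apply (TensorProduct.assoc k P N M).symm.injective
  apply hinj
  have hnat := braidSigma_natural (σ := σ) (lM := lM) (αM := αM) (braidSigma k σ lN lP αN αP)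
    (lX := tildeCoaction k μ lN lP) (αX := TensorProduct.congr αN αP)
    (lY := tildeCoaction k μ lP lN) (αY := TensorProduct.congr αP αN)
    (braidSigma_colinear hCQT hσ hN hP) (braidSigma_map hσ hN hP).symm (αM m ⊗ₜ (n ⊗ₜ p))
  rw [hNP, hPN, aTilde_braid_left, TensorProduct.map_tmul] at hnat
  simp only [TensorProduct.AlgebraTensorModule.curry_apply, LinearMap.restrictScalars_self,
    TensorProduct.curry_apply, LinearMap.comp_apply, LinearEquiv.coe_coe,
    TensorProduct.assoc_symm_tmul, TensorProduct.map_tmul, LinearMap.id_apply,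
    LinearEquiv.symm_apply_apply] at hnat ⊢
  rw [← LinearMap.comp_apply (TensorProduct.map _ _), ← TensorProduct.map_comp,
    LinearMap.comp_id, LinearMap.id_comp] at hnat
  rw [← LinearMap.comp_apply (TensorProduct.map _ _) (TensorProduct.map _ _),
    ← TensorProduct.map_comp, LinearMap.comp_id, LinearMap.id_comp, hnat]
  generalize braidSigma k σ lN lP αN αP (n ⊗ₜ p) = t
  induction t with
  | zero => simp
  | add _ _ h₁ h₂ => simp only [TensorProduct.tmul_add, map_add, h₁, h₂]
  | tmul p n =>
    rw [aTilde_braid_left]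
    simp

end Auxiliary

/-- for comodules over a coquasitriangular Hom-bialgebra (with `αH` bijective
and `σ = σ ∘ (α ⊗ α)`), the maps `c_{X,Y}(x⊗y) = σ(y₍₋₁₎ ⊗ x₍₋₁₎) αY⁻¹(y₍₀₎) ⊗ αX⁻¹(x₍₀₎)`
commute with the structure maps, are H-colinear, satisfy the braid relation and the two
hexagon relations. -/
theorem stmt19 {k H M N P : Type*} [Field k]
    [AddCommGroup H] [Module k H] [AddCommGroup M] [Module k M]
    [AddCommGroup N] [Module k N] [AddCommGroup P] [Module k P]
    (μ : H ⊗[k] H →ₗ[k] H) (Δ : H →ₗ[k] H ⊗[k] H) (αH : H ≃ₗ[k] H)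
    (σ : H ⊗[k] H →ₗ[k] k)
    (hCQT : IsCoquasitriangular k μ Δ αH.toLinearMap σ)
    (hσ : σ ∘ₗ TensorProduct.map αH.toLinearMap αH.toLinearMap = σ)
    (lM : M →ₗ[k] H ⊗[k] M) (αM : M ≃ₗ[k] M)
    (hM : IsHomComodule k Δ αH.toLinearMap lM αM.toLinearMap)
    (lN : N →ₗ[k] H ⊗[k] N) (αN : N ≃ₗ[k] N)
    (hN : IsHomComodule k Δ αH.toLinearMap lN αN.toLinearMap)
    (lP : P →ₗ[k] H ⊗[k] P) (αP : P ≃ₗ[k] P)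
    (hP : IsHomComodule k Δ αH.toLinearMap lP αP.toLinearMap) :
    (TensorProduct.map αN.toLinearMap αM.toLinearMap ∘ₗ braidSigma k σ lM lN αM αN
      = braidSigma k σ lM lN αM αN ∘ₗ TensorProduct.map αM.toLinearMap αN.toLinearMap) ∧
    (TensorProduct.map (LinearMap.id : H →ₗ[k] H) (braidSigma k σ lM lN αM αN) ∘ₗ
        tildeCoaction k μ lM lN
      = tildeCoaction k μ lN lM ∘ₗ braidSigma k σ lM lN αM αN) ∧
    (TensorProduct.map (LinearMap.id : P →ₗ[k] P) (braidSigma k σ lM lN αM αN) ∘ₗ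
        (TensorProduct.assoc k P M N).toLinearMap ∘ₗ
          TensorProduct.map (braidSigma k σ lM lP αM αP) (LinearMap.id : N →ₗ[k] N) ∘ₗ
            (TensorProduct.assoc k M P N).symm.toLinearMap ∘ₗ
              TensorProduct.map (LinearMap.id : M →ₗ[k] M) (braidSigma k σ lN lP αN αP)
      = (TensorProduct.assoc k P N M).toLinearMap ∘ₗ
          TensorProduct.map (braidSigma k σ lN lP αN αP) (LinearMap.id : M →ₗ[k] M) ∘ₗ
            (TensorProduct.assoc k N P M).symm.toLinearMap ∘ₗ
              TensorProduct.map (LinearMap.id : N →ₗ[k] N) (braidSigma k σ lM lP αM αP) ∘ₗ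
                (TensorProduct.assoc k N M P).toLinearMap ∘ₗ
                  TensorProduct.map (braidSigma k σ lM lN αM αN)
                    (LinearMap.id : P →ₗ[k] P) ∘ₗ
                    (TensorProduct.assoc k M N P).symm.toLinearMap) ∧
    (aTilde k αN P αM ∘ₗ
        braidSigma k σ lM (tildeCoaction k μ lN lP) αM (TensorProduct.congr αN αP) ∘ₗ
          aTilde k αM N αP
      = TensorProduct.map (LinearMap.id : N →ₗ[k] N) (braidSigma k σ lM lP αM αP) ∘ₗ
          aTilde k αN M αP ∘ₗ
            TensorProduct.map (braidSigma k σ lM lN αM αN) (LinearMap.id : P →ₗ[k] P)) ∧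
    (aTildeInv k αP M αN ∘ₗ
        braidSigma k σ (tildeCoaction k μ lM lN) lP (TensorProduct.congr αM αN) αP ∘ₗ
          aTildeInv k αM N αP
      = TensorProduct.map (braidSigma k σ lM lP αM αP) (LinearMap.id : N →ₗ[k] N) ∘ₗ
          aTildeInv k αM P αN ∘ₗ
            TensorProduct.map (LinearMap.id : M →ₗ[k] M) (braidSigma k σ lN lP αN αP)) := by
  exact ⟨braidSigma_map hσ hM hN, braidSigma_colinear hCQT hσ hM hN,
    braidSigma_braid hCQT hσ hM hN hP, braidSigma_hexagon hCQT hσ hM hP,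
    braidSigma_hexagon_inv hCQT hσ hM hP⟩

end HomYD
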